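/- arXiv:2211.01196 — 3 statements merged into one kernel-verified Lean document; each statement's English description precedes it below -/
import Mathlib

section
/- Let V ⊆ ℂ^k be a connected open set. Let H, H_1, …, H_{κ₁+κ₂} be Nash algebraic holomorphic functions on V, each nowhere vanishing on V, and let u, u_1, …, u_{κ₁+κ₂} be holomorphic functions on V with exp(u) = H and exp(u_j) = H_j on V (holomorphic branches of the logarithms). Let μ, μ_1, …, μ_{κ₁+κ₂} be non-zero real numbers, and let P, Q be one-variable polynomials with real coefficients. Set A(ξ) = exp(Σ_{j=1}^{κ₁} μ_j u_j(ξ)) (so A = ∏_{j=1}^{κ₁} H_j^{μ_j}) and B(ξ) = exp(Σ_{j=κ₁+1}^{κ₁+κ₂} μ_j u_j(ξ)), and assume Q(A(ξ)) ≠ 0 for all ξ ∈ V. If exp( P(A(ξ)) · B(ξ) / Q(A(ξ)) ) = exp(μ · u(ξ)) for all ξ ∈ V, then H is constant on V. (Lemma 2.6, case (9): exp{R(∏ H_j^{μ_j}) ∏ H_j^{μ_j}} = H^μ forces H constant.) -/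
open scoped BigOperators

/-- A holomorphic function `f` on an open set `V ⊆ ℂ^k` is *Nash algebraic* if there is a
nonzero polynomial `P` in the variables `(z₁, …, z_k, y)` with complex coefficients such that
`P(z, f z) = 0` for all `z ∈ V`. -/
def NashAlgebraicOn {k : ℕ} (f : (Fin k → ℂ) → ℂ) (V : Set (Fin k → ℂ)) : Prop :=
  ∃ P : MvPolynomial (Fin k ⊕ Unit) ℂ, P ≠ 0 ∧
    ∀ z ∈ V, MvPolynomial.eval (Sum.elim z fun _ => f z) P = 0

open Polynomial Differential in
theorem coeff_implicitDeriv_C_mul_X {K : Type*} [Field K] [Differential K] (a : K) (p : K[X])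
    (i : ℕ) : (implicitDeriv (C a * X) p).coeff i = (p.coeff i)′ + i * a * p.coeff i := by
  have h : implicitDeriv (C a * X) p = mapCoeffs p + (C a * X) * derivative p := rfl
  rw [h, coeff_add, coeff_mapCoeffs, mul_assoc, coeff_C_mul]
  cases i with
  | zero => simp
  | succ n => rw [coeff_X_mul, coeff_derivative]; push_cast; ring

open Polynomial Differential in
theorem natDegree_implicitDeriv_C_mul_X_le {K : Type*} [Field K] [Differential K] (a : K)
    (p : K[X]) : (implicitDeriv (C a * X) p).natDegree ≤ p.natDegree := by
  rw [natDegree_le_iff_coeff_eq_zero]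
  intro i hi
  simp [coeff_implicitDeriv_C_mul_X, coeff_eq_zero_of_natDegree_lt hi]

section Differential
open Polynomial Differential

variable {K M : Type*} [Field K] [Field M] [Differential K] [Differential M] [Algebra K M]
  [DifferentialAlgebra K M] [ContainConstants K M]

/-- If `A` is exponential over a differential field `K` and transcendental over `K`, then every
element of `K(A)` whose derivative lies in `K` lies in `K` itself. -/
theorem mem_range_of_deriv_mem_of_transcendental {A : M} (hA : Transcendental K A) {a : K}
    (ha : A′ = algebraMap K M a * A) {w : M} {v : K} (hw : w′ = algebraMap K M v)
    {S T : K[X]} (hT : T ≠ 0) (hST : w * aeval A T = aeval A S) :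
    w ∈ (algebraMap K M).range := by
  have hinj := transcendental_iff_injective.1 hA
  have hA0 : A ≠ 0 := by rintro rfl; exact hA isAlgebraic_zero
  have hder (p : K[X]) : (aeval A p)′ = aeval A (implicitDeriv (C a * X) p) :=
    deriv_aeval_eq_implicitDeriv A _ (by simp [ha]) p
  set S' := implicitDeriv (C a * X) S with hS'
  set T' := implicitDeriv (C a * X) T with hT'
  have key : C v * (T * T) = S' * T - S * T' := by
    apply hinj
    have h1 := congrArg (fun x => x′) hST
    simp only [Derivation.leibniz, smul_eq_mul, hder, hw] at h1
    simp only [map_mul, map_sub, aeval_C, ← hS', ← hT'] at h1 ⊢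
    linear_combination aeval A T * h1 - aeval A T' * hST
  have hSd : S'.natDegree ≤ S.natDegree := natDegree_implicitDeriv_C_mul_X_le a S
  have hTd : T'.natDegree ≤ T.natDegree := natDegree_implicitDeriv_C_mul_X_le a T
  set m := T.natDegree with hm
  have htm : T.coeff m ≠ 0 := by simpa [hm] using hT
  set tm := T.coeff m
  have const_mem {f : M} (hf : f′ = 0) : f ∈ (algebraMap K M).range :=
    mem_range_of_deriv_eq_zero K hf
  rcases le_or_gt S.natDegree m with hle | hlt
  · have h2 := congrArg (fun p => p.coeff (m + m)) key
    simp only [coeff_sub, coeff_C_mul] at h2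
    rw [coeff_mul_add_eq_of_natDegree_le hm.ge hm.ge,
      coeff_mul_add_eq_of_natDegree_le (hSd.trans hle) hm.ge,
      coeff_mul_add_eq_of_natDegree_le hle hTd, hS', hT', coeff_implicitDeriv_C_mul_X,
      coeff_implicitDeriv_C_mul_X] at h2
    have h3 : (S.coeff m / tm)′ = v := by
      rw [Derivation.leibniz_div]
      simp only [smul_eq_mul]
      field_simp
      linear_combination -h2
    have h4 : (w - algebraMap K M (S.coeff m / tm))′ = 0 := by
      rw [map_sub, hw, deriv_algebraMap, h3, sub_self]
    obtain ⟨c, hc⟩ := const_mem h4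
    exact ⟨c + S.coeff m / tm, by rw [map_add, hc]; ring⟩
  · exfalso
    set n := S.natDegree with hn
    have hsn : S.coeff n ≠ 0 := by
      rw [hn, coeff_natDegree, Ne, leadingCoeff_eq_zero]
      rintro rfl
      simp [hn] at hlt
    set sn := S.coeff n
    have h2 := congrArg (fun p => p.coeff (n + m)) key
    simp only [coeff_sub, coeff_C_mul] at h2
    rw [coeff_eq_zero_of_natDegree_lt (natDegree_mul_le.trans_lt (by lia)),
      coeff_mul_add_eq_of_natDegree_le hSd hm.ge,
      coeff_mul_add_eq_of_natDegree_le hn.ge hTd, hS', hT', coeff_implicitDeriv_C_mul_X,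
      coeff_implicitDeriv_C_mul_X] at h2
    change v * 0 = (sn′ + n * a * sn) * tm - sn * (tm′ + m * a * tm) at h2
    clear_value sn tm
    obtain ⟨d, hd⟩ : ∃ d, n = m + (d + 1) := ⟨n - m - 1, by lia⟩
    have h3 : (algebraMap K M (sn / tm) * A ^ (n - m))′ = 0 := by
      have hq : (sn / tm)′ = -((d + 1) * a * (sn / tm)) := by
        rw [Derivation.leibniz_div]
        simp only [smul_eq_mul]
        rw [hd] at h2
        push_cast at h2
        field_simp
        linear_combination -h2
      rw [Derivation.leibniz, Derivation.leibniz_pow, deriv_algebraMap, hq, ha, hd,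
        Nat.add_sub_cancel_left, Nat.add_sub_cancel]
      simp only [smul_eq_mul, map_mul, map_add, map_neg, map_natCast, map_one, nsmul_eq_mul]
      push_cast
      ring
    obtain ⟨c, hc⟩ := const_mem h3
    have hs : algebraMap K M (sn / tm) ≠ 0 := by simpa using ⟨hsn, htm⟩
    have : IsAlgebraic K (A ^ (n - m)) := by
      have : A ^ (n - m) = algebraMap K M (c / (sn / tm)) := by
        rw [map_div₀, hc]; field_simp
      rw [this]; exact isAlgebraic_algebraMap _
    exact hA (this.of_pow (by lia))

/-- If `A`, `B` are exponential over a relatively algebraically closed differential subfield `K`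
sharing constants, `w = P(A) B / Q(A)`, and the derivative of `w` lies in `K`, then `w` lies in
`K`. -/
theorem mem_range_of_mul_aeval_eq (hK : ∀ f : M, IsAlgebraic K f → f ∈ (algebraMap K M).range)
    {A B : M} {a b : K} (ha : A′ = algebraMap K M a * A)
    (hb : B′ = algebraMap K M b * B) {w : M} {v : K} (hw : w′ = algebraMap K M v)
    {P Q : K[X]} (hQ : aeval A Q ≠ 0) (hPQ : w * aeval A Q = aeval A P * B) :
    w ∈ (algebraMap K M).range := by
  by_cases hv : v = 0
  · exact mem_range_of_deriv_eq_zero K (by simp [hw, hv])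
  have hw0 : w ≠ 0 := by
    rintro rfl
    apply hv
    have : algebraMap K M v = 0 := by simp [← hw]
    simpa using this
  have hP : aeval A P ≠ 0 := by
    intro h
    rw [h, zero_mul] at hPQ
    exact (mul_ne_zero hw0 hQ) hPQ
  set δ := implicitDeriv (C a * X)
  have hder (p : K[X]) : (aeval A p)′ = aeval A (δ p) :=
    deriv_aeval_eq_implicitDeriv A _ (by simp [ha]) p
  have h2 : w * aeval A (δ P * Q - δ Q * P + C b * P * Q) = aeval A (C v * P * Q) := by
    have h1 := congrArg (fun x => x′) hPQ
    simp only [Derivation.leibniz, smul_eq_mul, hder, hw, hb] at h1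
    simp only [map_mul, map_sub, map_add, aeval_C] at h1 ⊢
    linear_combination (-aeval A P) * h1 + (aeval A (δ P) + algebraMap K M b * aeval A P) * hPQ
  set N := δ P * Q - δ Q * P + C b * P * Q
  have hN : aeval A N ≠ 0 := by
    intro h
    rw [h, mul_zero] at h2
    simp [hP, hQ, hv] at h2
  by_cases hA : IsAlgebraic K A
  · obtain ⟨x, rfl⟩ := hK A hA
    refine ⟨eval x (C v * P * Q) / eval x N, ?_⟩
    simp only [aeval_algebraMap_apply, coe_aeval_eq_eval] at h2 hN
    rw [map_div₀, ← h2]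
    field_simp
  · exact mem_range_of_deriv_mem_of_transcendental hA ha hw (by rintro h; simp [h] at hN) h2
end Differential

section Germs
open Filter Topology

/-- The algebra of functions that are meromorphic at the origin. -/
noncomputable def meromorphicAtZero : Subalgebra ℂ (ℂ → ℂ) where
  carrier := {f | MeromorphicAt f 0}
  mul_mem' := MeromorphicAt.mul
  add_mem' := MeromorphicAt.add
  algebraMap_mem' c := MeromorphicAt.const c 0

/-- The map sending a function that is meromorphic at the origin to its germ. -/
noncomputable def toGerm : meromorphicAtZero →+* Germ (𝓝[≠] (0 : ℂ)) ℂ :=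
  (Germ.coeRingHom _).comp meromorphicAtZero.val.toRingHom

/-- The field of germs of meromorphic functions at the origin. -/
def MeroGerm : Type := toGerm.range

namespace MeroGerm

noncomputable instance : CommRing MeroGerm := inferInstanceAs (CommRing toGerm.range)

/-- The germ of a meromorphic function. -/
noncomputable def mk : meromorphicAtZero →+* MeroGerm := toGerm.rangeRestrict

theorem mk_surjective : Function.Surjective mk := toGerm.rangeRestrict_surjective

theorem mk_eq_mk {f g : meromorphicAtZero} :
    mk f = mk g ↔ (f : ℂ → ℂ) =ᶠ[𝓝[≠] 0] (g : ℂ → ℂ) :=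
  Subtype.ext_iff.trans Germ.coe_eq

theorem mk_eq_zero {f : meromorphicAtZero} : mk f = 0 ↔ ∀ᶠ z in 𝓝[≠] 0, (f : ℂ → ℂ) z = 0 := by
  rw [← map_zero mk, mk_eq_mk]; rfl

instance : Nontrivial MeroGerm := by
  refine ⟨0, 1, fun h => ?_⟩
  rw [eq_comm, ← map_one mk, mk_eq_zero] at h
  obtain ⟨z, hz⟩ := h.exists
  exact one_ne_zero hz

theorem isUnit_or_eq_zero (x : MeroGerm) : IsUnit x ∨ x = 0 := by
  obtain ⟨f, rfl⟩ := mk_surjective x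
  rcases f.2.eventually_eq_zero_or_eventually_ne_zero with h | h
  · exact Or.inr (mk_eq_zero.2 h)
  · refine Or.inl (IsUnit.of_mul_eq_one (mk ⟨_, f.2.inv⟩) ?_)
    rw [← map_mul, ← map_one mk, mk_eq_mk]
    filter_upwards [h] with z hz
    exact mul_inv_cancel₀ hz

noncomputable instance : Field MeroGerm := Field.ofIsUnitOrEqZero isUnit_or_eq_zero

noncomputable instance : Algebra ℂ MeroGerm := (mk.comp (algebraMap ℂ meromorphicAtZero)).toAlgebra

/-- `MeroGerm.mk` as an algebra homomorphism. -/
noncomputable def mkₐ : meromorphicAtZero →ₐ[ℂ] MeroGerm := { mk with commutes' := fun _ => rfl }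

/-- The derivative of a meromorphic function. -/
noncomputable def derivFun (f : meromorphicAtZero) : meromorphicAtZero := ⟨deriv f, f.2.deriv⟩

theorem mk_derivFun_congr {f g : meromorphicAtZero} (h : mk f = mk g) :
    mk (derivFun f) = mk (derivFun g) :=
  mk_eq_mk.2 (mk_eq_mk.1 h).nhdsNE_deriv

theorem eventually_differentiableAt (f : meromorphicAtZero) :
    ∀ᶠ z in 𝓝[≠] 0, DifferentiableAt ℂ (f : ℂ → ℂ) z :=
  f.2.eventually_analyticAt.mono fun _ h => h.differentiableAt

theorem mk_derivFun_add (f g : meromorphicAtZero) :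
    mk (derivFun (f + g)) = mk (derivFun f) + mk (derivFun g) := by
  rw [← map_add, mk_eq_mk]
  filter_upwards [eventually_differentiableAt f, eventually_differentiableAt g] with z hf hg
  exact deriv_add hf hg

theorem mk_derivFun_mul (f g : meromorphicAtZero) :
    mk (derivFun (f * g)) = mk f * mk (derivFun g) + mk g * mk (derivFun f) := by
  rw [← map_mul, ← map_mul, ← map_add, mk_eq_mk]
  filter_upwards [eventually_differentiableAt f, eventually_differentiableAt g] with z hf hg
  refine (deriv_mul hf hg).trans ?_
  rw [add_comm, mul_comm (deriv (f : ℂ → ℂ) z)]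
  rfl

/-- Differentiation of germs of meromorphic functions. -/
noncomputable def derivGerm (x : MeroGerm) : MeroGerm := mk (derivFun (mk_surjective x).choose)

theorem derivGerm_mk (f : meromorphicAtZero) : derivGerm (mk f) = mk (derivFun f) :=
  mk_derivFun_congr (mk_surjective (mk f)).choose_spec

theorem derivGerm_add (x y : MeroGerm) : derivGerm (x + y) = derivGerm x + derivGerm y := by
  obtain ⟨f, rfl⟩ := mk_surjective x
  obtain ⟨g, rfl⟩ := mk_surjective y
  rw [← map_add, derivGerm_mk, derivGerm_mk, derivGerm_mk, mk_derivFun_add]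

theorem derivGerm_mul (x y : MeroGerm) :
    derivGerm (x * y) = x * derivGerm y + y * derivGerm x := by
  obtain ⟨f, rfl⟩ := mk_surjective x
  obtain ⟨g, rfl⟩ := mk_surjective y
  rw [← map_mul, derivGerm_mk, derivGerm_mk, derivGerm_mk, mk_derivFun_mul]

noncomputable instance : Differential MeroGerm where
  deriv := Derivation.mk' (AddMonoidHom.mk' derivGerm derivGerm_add).toIntLinearMap derivGerm_mul

open scoped Differential

theorem deriv_mk (f : meromorphicAtZero) : (mk f)′ = mk (derivFun f) := derivGerm_mk f

theorem deriv_algebraMap_complex (c : ℂ) : (algebraMap ℂ MeroGerm c)′ = 0 := by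
  refine (deriv_mk _).trans (mk_eq_zero.2 (Eventually.of_forall fun z => ?_))
  exact deriv_const z c

theorem exists_algebraMap_of_deriv_eq_zero {x : MeroGerm} (hx : x′ = 0) :
    ∃ c : ℂ, x = algebraMap ℂ MeroGerm c := by
  obtain ⟨f, rfl⟩ := mk_surjective x
  rw [deriv_mk, mk_eq_zero] at hx
  replace hx : ∀ᶠ z in 𝓝[≠] 0, deriv (f : ℂ → ℂ) z = 0 := hx
  have hf : MeromorphicAt (f : ℂ → ℂ) 0 := f.2
  have hord : 0 ≤ meromorphicOrderAt (f : ℂ → ℂ) 0 := by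
    by_contra! h
    obtain ⟨n, hn⟩ := WithTop.ne_top_iff_exists.1 h.ne_top
    have hn0 : n ≠ 0 := by rintro rfl; simp [← hn] at h
    have := meromorphicOrderAt_deriv_eq_sub_one (Int.cast_ne_zero.2 hn0) hn.symm
    rw [meromorphicOrderAt_eq_top_iff.2 hx] at this
    exact WithTop.coe_ne_top this.symm
  obtain ⟨g, hg, hfg⟩ : ∃ g : ℂ → ℂ, AnalyticAt ℂ g 0 ∧ (f : ℂ → ℂ) =ᶠ[𝓝[≠] 0] g := by
    rcases eq_or_ne (meromorphicOrderAt (f : ℂ → ℂ) 0) ⊤ with h | h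
    · exact ⟨0, analyticAt_const, meromorphicOrderAt_eq_top_iff.1 h⟩
    · obtain ⟨g, hg, -, h⟩ := (meromorphicOrderAt_ne_top_iff hf).1 h
      refine ⟨fun z => z ^ (meromorphicOrderAt (f : ℂ → ℂ) 0).untop₀.toNat * g z, by fun_prop, ?_⟩
      filter_upwards [h] with z hz
      rw [hz, sub_zero, smul_eq_mul, ← zpow_natCast, Int.toNat_of_nonneg]
      exact WithTop.untop₀_nonneg.2 hord
  have hg' : ∀ᶠ z in 𝓝[≠] 0, deriv g z = 0 := by
    filter_upwards [hfg.nhdsNE_deriv, hx] with z h1 h2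
    rw [← h1, h2]
  have hg'' : ∀ᶠ z in 𝓝 0, deriv g z = 0 :=
    (hg.deriv.frequently_zero_iff_eventually_zero).1 hg'.frequently
  obtain ⟨r, hr, hball⟩ := Metric.eventually_nhds_iff_ball.1
    (hg''.and hg.eventually_analyticAt)
  refine ⟨g 0, mk_eq_mk.2 ?_⟩
  filter_upwards [hfg, mem_nhdsWithin_of_mem_nhds (Metric.ball_mem_nhds 0 hr)] with z h1 h2
  rw [h1]
  exact Metric.isOpen_ball.is_const_of_deriv_eq_zero (convex_ball _ _).isPreconnected
    (fun y hy => (hball y hy).2.differentiableAt.differentiableWithinAt)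
    (fun y hy => (hball y hy).1) h2 (Metric.mem_ball_self hr)

end MeroGerm
end Germs

section AlgebraicGerms
open Polynomial Differential Algebra Topology

theorem IsAlgebraic.deriv {F M : Type*} [Field F] [CharZero F] [Field M] [Differential F]
    [Differential M] [Algebra F M] [DifferentialAlgebra F M] {x : M} (hx : IsAlgebraic F x) :
    IsAlgebraic F x′ := by
  have h := deriv_aeval_eq x (minpoly F x)
  rw [minpoly.aeval, map_zero] at h
  have hne : aeval x (derivative (minpoly F x)) ≠ 0 :=
    (minpoly.irreducible hx.isIntegral).separable.aeval_derivative_ne_zero (minpoly.aeval F x)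
  have e : x′ = -aeval x (mapCoeffs (minpoly F x)) / aeval x (derivative (minpoly F x)) := by
    rw [eq_div_iff hne]; linear_combination -h
  have hmem (p : F[X]) : aeval x p ∈ algebraicClosure F M := by
    have := aeval_algebraMap_apply M (⟨x, mem_algebraicClosure_iff.2 hx⟩ : algebraicClosure F M) p
    exact this ▸ SetLike.coe_mem _
  rw [e, ← mem_algebraicClosure_iff]
  exact div_mem (neg_mem (hmem _)) (hmem _)

/-- The differential structure on an intermediate field that is stable under the derivation. -/
@[reducible]
def IntermediateField.differential {F M : Type*} [Field F] [Field M] [Differential M]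
    [Algebra F M] (E : IntermediateField F M) (hE : ∀ x ∈ E, x′ ∈ E) : Differential E where
  deriv := Derivation.mk'
    (AddMonoidHom.mk' (fun x : E => (⟨(x : M)′, hE x x.2⟩ : E))
      fun _ _ => Subtype.ext (map_add _ _ _)).toIntLinearMap
    fun _ _ => Subtype.ext (Derivation.leibniz _ _ _)

namespace MeroGerm

/-- The germ of the coordinate function. -/
noncomputable def coord : MeroGerm := mk ⟨id, MeromorphicAt.id 0⟩

theorem deriv_coord : coord′ = 1 := by
  refine (deriv_mk _).trans ?_
  rw [← map_one mk, mk_eq_mk]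
  exact Filter.Eventually.of_forall fun z => deriv_id z

/-- The field of germs of rational functions. -/
noncomputable abbrev ratGerms : IntermediateField ℂ MeroGerm := IntermediateField.adjoin ℂ {coord}

theorem deriv_mem_ratGerms (x : MeroGerm) (hx : x ∈ ratGerms) : x′ ∈ ratGerms := by
  induction hx using IntermediateField.adjoin_induction with
  | mem x hx => rw [Set.mem_singleton_iff.1 hx, deriv_coord]; exact one_mem _
  | algebraMap c => rw [deriv_algebraMap_complex]; exact zero_mem _
  | add x y _ _ h1 h2 => rw [map_add]; exact add_mem h1 h2
  | inv x hx h =>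
    rw [Derivation.leibniz_inv]
    exact mul_mem (neg_mem (pow_mem (inv_mem hx) 2)) h
  | mul x y hx hy h1 h2 =>
    rw [Derivation.leibniz]
    exact add_mem (mul_mem hx h2) (mul_mem hy h1)

noncomputable instance : Differential ratGerms := ratGerms.differential deriv_mem_ratGerms

instance : DifferentialAlgebra ratGerms MeroGerm := ⟨fun _ => rfl⟩

/-- The field of germs of algebraic functions. -/
noncomputable abbrev algGerms : IntermediateField ratGerms MeroGerm :=
  algebraicClosure ratGerms MeroGerm

noncomputable instance : Differential algGerms :=
  algGerms.differential fun _ hx => mem_algebraicClosure_iff.2 (mem_algebraicClosure_iff.1 hx).deriv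

instance : DifferentialAlgebra algGerms MeroGerm := ⟨fun _ => rfl⟩

instance : IsScalarTower ℂ algGerms MeroGerm := IsScalarTower.of_algebraMap_eq fun _ => rfl

theorem algebraMap_mem_algGerms (c : ℂ) : algebraMap ℂ MeroGerm c ∈ algGerms :=
  algGerms.algebraMap_mem (algebraMap ℂ ratGerms c)

instance : ContainConstants algGerms MeroGerm where
  mem_range_of_deriv_eq_zero {x} hx := by
    obtain ⟨c, rfl⟩ := exists_algebraMap_of_deriv_eq_zero hx
    exact ⟨⟨_, algebraMap_mem_algGerms c⟩, rfl⟩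

theorem mem_range_of_isAlgebraic_algGerms (f : MeroGerm) (hf : IsAlgebraic algGerms f) :
    f ∈ (algebraMap algGerms MeroGerm).range :=
  ⟨⟨f, (mem_algebraicClosure_iff).2 (hf.restrictScalars ratGerms)⟩, rfl⟩

theorem transcendental_coord : Transcendental ℂ coord := by
  intro h
  have : Algebra.IsAlgebraic ℂ (IntermediateField.adjoin ℂ {coord}) :=
    IntermediateField.isAlgebraic_adjoin (by simpa using h.isIntegral)
  have hmem : coord ∈ (⊥ : IntermediateField ℂ MeroGerm) := by
    rw [← IntermediateField.eq_bot_of_isAlgClosed_of_isAlgebraic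
      (IntermediateField.adjoin ℂ {coord})]
    exact IntermediateField.mem_adjoin_simple_self ℂ coord
  obtain ⟨c, hc⟩ := IntermediateField.mem_bot.1 hmem
  have := deriv_coord
  rw [← hc, deriv_algebraMap_complex] at this
  exact zero_ne_one this

open IntermediateField.algebraAdjoinAdjoin in
theorem trdeg_algGerms_le : Algebra.trdeg ℂ algGerms ≤ 1 := by
  have h0 : Algebra.trdeg ℂ (Algebra.adjoin ℂ {coord}) ≤ 1 := by
    rw [← Polynomial.trdeg_of_isDomain (R := ℂ)]
    refine trdeg_le_of_surjective ((aeval coord).codRestrict (Algebra.adjoin ℂ {coord}) fun p =>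
      aeval_mem_adjoin_singleton ℂ coord) fun x => ?_
    obtain ⟨p, hp⟩ := (Algebra.adjoin_singleton_eq_range_aeval ℂ coord).le x.2
    exact ⟨p, Subtype.ext hp⟩
  have : FaithfulSMul ratGerms algGerms :=
    (faithfulSMul_iff_algebraMap_injective _ _).2 (algebraMap ratGerms algGerms).injective
  rw [← trdeg_add_eq ℂ ratGerms (A := algGerms), trdeg_eq_zero (R := ratGerms), add_zero,
    ← trdeg_add_eq ℂ (Algebra.adjoin ℂ {coord}) (A := ratGerms),
    trdeg_eq_zero (R := Algebra.adjoin ℂ {coord}), add_zero]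
  exact h0

theorem exists_mvPolynomial_of_mem_algGerms {x y : MeroGerm} (hx : x ∈ algGerms)
    (hy : y ∈ algGerms) :
    ∃ p : MvPolynomial (Fin 2) ℂ, p ≠ 0 ∧ MvPolynomial.aeval ![x, y] p = 0 := by
  by_contra! h
  have hind : AlgebraicIndependent ℂ ![(⟨x, hx⟩ : algGerms), ⟨y, hy⟩] := by
    rw [algebraicIndependent_iff]
    intro p hp
    by_contra hp0
    apply h p hp0
    have e : (![x, y] : Fin 2 → MeroGerm) =
        algebraMap algGerms MeroGerm ∘ ![(⟨x, hx⟩ : algGerms), ⟨y, hy⟩] := by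
      ext i; fin_cases i <;> rfl
    rw [e, MvPolynomial.aeval_algebraMap_apply, hp, map_zero]
  have := hind.cardinalMk_le_trdeg.trans trdeg_algGerms_le
  simp at this

/-- A meromorphic germ satisfying a polynomial relation along a line is algebraic, provided the
relation does not degenerate at the base point of the line. -/
theorem mk_mem_algGerms {k : ℕ} {f : meromorphicAtZero} {P : MvPolynomial (Fin k ⊕ Unit) ℂ}
    {z₀ v : Fin k → ℂ} {y₀ : ℂ} (hP : MvPolynomial.eval (Sum.elim z₀ fun _ => y₀) P ≠ 0)
    (hf : ∀ᶠ t in 𝓝[≠] 0,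
      MvPolynomial.eval (Sum.elim (z₀ + t • v) fun _ => (f : ℂ → ℂ) t) P = 0) :
    mk f ∈ algGerms := by
  let φ : MvPolynomial (Fin k ⊕ Unit) ℂ →+* ℂ[X][X] := MvPolynomial.eval₂Hom (C.comp C)
    (Sum.elim (fun i => C (C (z₀ i) + X * C (v i))) fun _ => X)
  have hp : φ P ≠ 0 := by
    intro h
    apply hP
    have e : (evalEvalRingHom 0 y₀).comp φ = MvPolynomial.eval (Sum.elim z₀ fun _ => y₀) := by
      refine MvPolynomial.ringHom_ext (fun c => ?_) ?_
      · simp [φ]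
      · rintro (i | i) <;> simp [φ]
    rw [← e, RingHom.comp_apply, h, map_zero]
  let g : ratGerms := ⟨coord, IntermediateField.mem_adjoin_simple_self ℂ coord⟩
  let ψ : ℂ[X] →+* ratGerms := (aeval g : ℂ[X] →ₐ[ℂ] ratGerms).toRingHom
  have hψ : Function.Injective ψ := by
    refine transcendental_iff_injective.1 (fun h => transcendental_coord ?_)
    exact h.algebraMap (A := MeroGerm)
  rw [mem_algebraicClosure_iff]
  refine ⟨(φ P).map ψ, (Polynomial.map_ne_zero_iff hψ).2 hp, ?_⟩
  let F : Fin k ⊕ Unit → meromorphicAtZero := Sum.elim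
    (fun i => ⟨fun t => z₀ i + v i * t, by
      refine AnalyticAt.meromorphicAt ?_; fun_prop⟩) fun _ => f
  have e : ((aeval (mk f) : ratGerms[X] →ₐ[ratGerms] MeroGerm).toRingHom.comp
      (mapRingHom ψ)).comp φ = (mkₐ.comp (MvPolynomial.aeval F)).toRingHom := by
    refine MvPolynomial.ringHom_ext (fun c => ?_) ?_
    · simp [φ, ψ]
    · rintro (i | i)
      · simp [φ, ψ, F]
        rfl
      · simp [φ, F]
        rfl
  refine (RingHom.congr_fun e P).trans (mk_eq_zero.2 ?_)
  filter_upwards [hf] with t ht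
  rw [← ht]
  refine (MvPolynomial.comp_aeval_apply F
    ((Pi.evalAlgHom ℂ _ t).comp meromorphicAtZero.val) P).trans ?_
  rw [MvPolynomial.aeval_eq_eval]
  refine congrArg (fun x => MvPolynomial.eval x P) (funext ?_)
  rintro (i | i)
  · exact congrArg (z₀ i + ·) (mul_comm (v i) t)
  · rfl

end MeroGerm

/-- The exponential function is not algebraic on any open set. -/
theorem not_eventually_eval_exp_eq_zero {G : MvPolynomial (Fin 2) ℂ} (hG : G ≠ 0) (s₀ : ℂ) :
    ¬ ∀ᶠ s in 𝓝 s₀, MvPolynomial.eval ![s, Complex.exp s] G = 0 := by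
  intro h
  have hdiff : Differentiable ℂ fun s => MvPolynomial.eval ![s, Complex.exp s] G := by
    simp only [MvPolynomial.eval_eq', Fin.prod_univ_two, Matrix.cons_val_zero, Matrix.cons_val_one]
    fun_prop
  have hall (s : ℂ) : MvPolynomial.eval ![s, Complex.exp s] G = 0 := by
    have := AnalyticOnNhd.eq_of_eventuallyEq (g := fun _ => 0)
      (fun z _ => hdiff.analyticAt z) (fun _ _ => analyticAt_const) h
    exact congrFun this s
  apply hG
  refine MvPolynomial.funext_set ![Set.univ, {0}ᶜ] ?_ fun x hx => ?_
  · intro i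
    fin_cases i
    · exact Set.infinite_univ
    · exact (Set.finite_singleton (0 : ℂ)).infinite_compl
  have hy : x 1 ≠ 0 := hx 1 trivial
  let q : ℂ[X] := MvPolynomial.aeval ![X, C (x 1)] G
  have hq (s : ℂ) : q.eval s = MvPolynomial.eval ![s, x 1] G := by
    rw [← coe_aeval_eq_eval]
    refine (MvPolynomial.comp_aeval_apply ![X, C (x 1)] (aeval s : ℂ[X] →ₐ[ℂ] ℂ) G).trans ?_
    rw [MvPolynomial.aeval_eq_eval]
    congr 2
    ext i; fin_cases i <;> simp
  have hq0 : q = 0 := by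
    refine eq_zero_of_infinite_isRoot q ?_
    refine Set.infinite_of_injective_forall_mem
      (f := fun n : ℕ => Complex.log (x 1) + n * (2 * Real.pi * Complex.I)) ?_ fun n => ?_
    · intro m n hmn
      have := Complex.two_pi_I_ne_zero
      simpa [this] using hmn
    · have := hall (Complex.log (x 1) + n * (2 * Real.pi * Complex.I))
      rw [Complex.exp_periodic.nat_mul, Complex.exp_log hy] at this
      exact (hq _).trans this
  have := hq (x 0)
  rw [hq0, eval_zero] at this
  rw [map_zero, this]
  congr 2
  ext i; fin_cases i <;> rfl

end AlgebraicGerms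

section OneVariable
open Polynomial Differential Topology Filter

namespace MeroGerm

/-- A function that is analytic at the origin, viewed as a meromorphic one. -/
noncomputable def ofAnalytic (f : ℂ → ℂ) (hf : AnalyticAt ℂ f 0) : meromorphicAtZero :=
  ⟨f, hf.meromorphicAt⟩

variable {f : ℂ → ℂ}

theorem mk_exp_ne_zero (hf : AnalyticAt ℂ f 0) : mk (ofAnalytic _ hf.cexp) ≠ 0 := fun h => by
  obtain ⟨t, ht⟩ := (mk_eq_zero.1 h).exists
  exact Complex.exp_ne_zero _ ht

theorem deriv_mk_exp (hf : AnalyticAt ℂ f 0) :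
    (mk (ofAnalytic _ hf.cexp))′ = (mk (ofAnalytic f hf))′ * mk (ofAnalytic _ hf.cexp) := by
  rw [deriv_mk, deriv_mk, ← map_mul, mk_eq_mk]
  filter_upwards [eventually_differentiableAt (ofAnalytic f hf)] with t ht
  exact (deriv_cexp ht).trans (mul_comm _ _)

theorem deriv_mem_algGerms {x : MeroGerm} (hx : x ∈ algGerms) : x′ ∈ algGerms :=
  mem_algebraicClosure_iff.2 (mem_algebraicClosure_iff.1 hx).deriv

theorem deriv_mk_mem_algGerms (hf : AnalyticAt ℂ f 0)
    (h : mk (ofAnalytic _ hf.cexp) ∈ algGerms) : (mk (ofAnalytic f hf))′ ∈ algGerms := by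
  rw [← mul_div_cancel_right₀ (mk (ofAnalytic f hf))′ (mk_exp_ne_zero hf), ← deriv_mk_exp]
  exact div_mem (deriv_mem_algGerms h) h

theorem deriv_mk_sum_mem_algGerms {ι : Type*} [Fintype ι] {fs : ι → ℂ → ℂ} (c : ι → ℂ)
    (hfs : ∀ j, AnalyticAt ℂ (fs j) 0) (h : ∀ j, (mk (ofAnalytic (fs j) (hfs j)))′ ∈ algGerms)
    (hf : AnalyticAt ℂ (fun t => ∑ j, c j * fs j t) 0) :
    (mk (ofAnalytic _ hf))′ ∈ algGerms := by
  have e : mkₐ (ofAnalytic _ hf) = ∑ j, c j • mkₐ (ofAnalytic (fs j) (hfs j)) := by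
    simp only [← map_smul, ← map_sum]
    congr 1
    refine Subtype.ext (funext fun t => ?_)
    simp [ofAnalytic]
  have e' : mk (ofAnalytic _ hf) =
      ∑ j, algebraMap ℂ MeroGerm (c j) * mk (ofAnalytic (fs j) (hfs j)) := by
    simp only [Algebra.smul_def] at e
    exact e
  rw [e', map_sum]
  refine sum_mem fun j _ => ?_
  rw [Derivation.leibniz, deriv_algebraMap_complex, smul_zero, add_zero]
  exact mul_mem (algebraMap_mem_algGerms _) (h j)

theorem aeval_mk (f : meromorphicAtZero) (P : ℂ[X]) : aeval (mk f) P = mk (aeval f P) :=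
  aeval_algHom_apply mkₐ f P

theorem coe_aeval (f : meromorphicAtZero) (P : ℂ[X]) (t : ℂ) :
    (aeval f P : meromorphicAtZero).1 t = eval (f.1 t) P := by
  rw [← coe_aeval_eq_eval]
  exact (aeval_algHom_apply ((Pi.evalAlgHom ℂ _ t).comp meromorphicAtZero.val) f P).symm

theorem mk_mem_algGerms_of_exp_div_eq {a b u : ℂ → ℂ} (ha : AnalyticAt ℂ a 0)
    (hb : AnalyticAt ℂ b 0) (hu : AnalyticAt ℂ u 0) (ha' : (mk (ofAnalytic a ha))′ ∈ algGerms)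
    (hb' : (mk (ofAnalytic b hb))′ ∈ algGerms) (hu' : (mk (ofAnalytic u hu))′ ∈ algGerms)
    {P Q : ℂ[X]} (hQ : eval (Complex.exp (a 0)) Q ≠ 0)
    (h : ∀ᶠ t in 𝓝 0, Complex.exp (eval (Complex.exp (a t)) P * Complex.exp (b t) /
      eval (Complex.exp (a t)) Q) = Complex.exp (u t)) :
    mk (ofAnalytic u hu) ∈ algGerms := by
  have hpoly (R : ℂ[X]) : AnalyticAt ℂ (fun t => eval (Complex.exp (a t)) R) 0 :=
    (R.differentiable.analyticAt _).fun_comp ha.cexp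
  have hw := ((hpoly P).mul hb.cexp).div (hpoly Q) hQ
  have hwu : (mk (ofAnalytic _ hw))′ = (mk (ofAnalytic u hu))′ := by
    have e : mk (ofAnalytic _ hw.cexp) = mk (ofAnalytic _ hu.cexp) :=
      mk_eq_mk.2 (h.filter_mono nhdsWithin_le_nhds)
    refine mul_right_cancel₀ (mk_exp_ne_zero hu) ?_
    rw [← deriv_mk_exp, ← e, ← deriv_mk_exp]
  have hQ' : ∀ᶠ t in 𝓝[≠] 0, eval (Complex.exp (a t)) Q ≠ 0 :=
    ((hpoly Q).continuousAt.eventually_ne hQ).filter_mono nhdsWithin_le_nhds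
  have hmem : mk (ofAnalytic _ hw) ∈ (algebraMap algGerms MeroGerm).range := by
    refine mem_range_of_mul_aeval_eq mem_range_of_isAlgebraic_algGerms
      (a := ⟨_, ha'⟩) (b := ⟨_, hb'⟩) (v := ⟨_, hu'⟩) (deriv_mk_exp ha) (deriv_mk_exp hb) hwu
      (P := P.map (algebraMap ℂ algGerms)) (Q := Q.map (algebraMap ℂ algGerms)) ?_ ?_
    · rw [aeval_map_algebraMap, aeval_mk]
      intro h0
      obtain ⟨t, h1, h2⟩ := (hQ'.and (mk_eq_zero.1 h0)).exists
      exact h1 ((coe_aeval _ _ _).symm.trans h2)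
    · rw [aeval_map_algebraMap, aeval_map_algebraMap, aeval_mk, aeval_mk, ← map_mul, ← map_mul,
        mk_eq_mk]
      filter_upwards [hQ'] with t ht
      refine (congrArg (_ * ·) (coe_aeval _ _ _)).trans (Eq.trans ?_
        (congrArg (· * _) (coe_aeval _ _ _).symm))
      exact div_mul_cancel₀ _ ht
  obtain ⟨x, hx⟩ := hmem
  obtain ⟨c, hc⟩ := exists_algebraMap_of_deriv_eq_zero
    (x := mk (ofAnalytic _ hw) - mk (ofAnalytic u hu)) (by rw [map_sub, hwu, sub_self])
  rw [← sub_sub_cancel (mk (ofAnalytic _ hw)) (mk (ofAnalytic u hu)), hc, ← hx]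
  exact sub_mem x.2 (algebraMap_mem_algGerms c)

theorem eventually_eq_of_mem_algGerms {u : ℂ → ℂ} (hu : AnalyticAt ℂ u 0)
    (h : mk (ofAnalytic u hu) ∈ algGerms) (hexp : mk (ofAnalytic _ hu.cexp) ∈ algGerms) :
    ∀ᶠ t in 𝓝 0, u t = u 0 := by
  obtain ⟨G, hG, hG0⟩ := exists_mvPolynomial_of_mem_algGerms h hexp
  refine hu.eventually_constant_or_nhds_le_map_nhds.resolve_right fun hmap => ?_
  have e := MvPolynomial.comp_aeval_apply ![ofAnalytic u hu, ofAnalytic _ hu.cexp] mkₐ G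
  have e0 : mk (MvPolynomial.aeval ![ofAnalytic u hu, ofAnalytic _ hu.cexp] G) = 0 := by
    refine e.trans (Eq.trans ?_ hG0)
    refine congrArg (fun x => MvPolynomial.aeval x G) (funext fun i => ?_)
    fin_cases i <;> rfl
  have hne : ∀ᶠ t in 𝓝[≠] 0, MvPolynomial.eval ![u t, Complex.exp (u t)] G = 0 := by
    filter_upwards [mk_eq_zero.1 e0] with t ht
    rw [← ht]
    refine Eq.trans ?_ (MvPolynomial.comp_aeval_apply _
      ((Pi.evalAlgHom ℂ _ t).comp meromorphicAtZero.val) G).symm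
    rw [MvPolynomial.aeval_eq_eval]
    refine congrArg (fun x => MvPolynomial.eval x G) (funext fun i => ?_)
    fin_cases i <;> rfl
  have han : AnalyticAt ℂ (fun t => MvPolynomial.eval ![u t, Complex.exp (u t)] G) 0 := by
    simp only [MvPolynomial.eval_eq', Fin.prod_univ_two, Matrix.cons_val_zero, Matrix.cons_val_one]
    fun_prop
  refine not_eventually_eval_exp_eq_zero hG (u 0) (hmap ?_)
  exact han.frequently_zero_iff_eventually_zero.1 hne.frequently

theorem eventually_eq_of_exp_div_eq {a b u : ℂ → ℂ} {μ : ℂ} (hμ : μ ≠ 0)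
    (ha : AnalyticAt ℂ a 0)
    (hb : AnalyticAt ℂ b 0) (hu : AnalyticAt ℂ u 0) (ha' : (mk (ofAnalytic a ha))′ ∈ algGerms)
    (hb' : (mk (ofAnalytic b hb))′ ∈ algGerms) (hexp : mk (ofAnalytic _ hu.cexp) ∈ algGerms)
    {P Q : ℂ[X]} (hQ : eval (Complex.exp (a 0)) Q ≠ 0)
    (h : ∀ᶠ t in 𝓝 0, Complex.exp (eval (Complex.exp (a t)) P * Complex.exp (b t) /
      eval (Complex.exp (a t)) Q) = Complex.exp (μ * u t)) :
    ∀ᶠ t in 𝓝 0, u t = u 0 := by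
  have hμu : AnalyticAt ℂ (fun t => μ * u t) 0 := analyticAt_const.mul hu
  have e : mk (ofAnalytic _ hμu) = algebraMap ℂ MeroGerm μ * mk (ofAnalytic u hu) :=
    map_mul mk (algebraMap ℂ meromorphicAtZero μ) (ofAnalytic u hu)
  have hmem : mk (ofAnalytic _ hμu) ∈ algGerms := by
    refine mk_mem_algGerms_of_exp_div_eq ha hb hμu ha' hb' ?_ hQ h
    rw [e, Derivation.leibniz, deriv_algebraMap_complex, smul_zero, add_zero]
    exact mul_mem (algebraMap_mem_algGerms μ) (deriv_mk_mem_algGerms hu hexp)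
  refine eventually_eq_of_mem_algGerms hu ?_ hexp
  have hμ' : algebraMap ℂ MeroGerm μ ≠ 0 := (_root_.map_ne_zero _).2 hμ
  rw [← mul_div_cancel_left₀ (mk (ofAnalytic u hu)) hμ', ← e]
  exact div_mem hmem (algebraMap_mem_algGerms μ)

end MeroGerm
end OneVariable

section Lines
open Polynomial Topology MeroGerm

variable {k : ℕ}

theorem exists_eval_sumElim_ne_zero {P : MvPolynomial (Fin k ⊕ Unit) ℂ} (hP : P ≠ 0)
    {z : Fin k → ℂ} {r : ℝ} (hr : 0 < r) :
    ∃ z₀ ∈ Metric.ball z r, ∃ y₀ : ℂ, MvPolynomial.eval (Sum.elim z₀ fun _ => y₀) P ≠ 0 := by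
  by_contra! h
  refine hP (MvPolynomial.funext_set (Sum.elim (fun i => Metric.ball (z i) r) fun _ => Set.univ)
    ?_ fun x hx => ?_)
  · rintro (i | i)
    · exact infinite_of_mem_nhds (z i) (Metric.ball_mem_nhds _ hr)
    · exact Set.infinite_univ
  · have := h (x ∘ Sum.inl) ((dist_pi_lt_iff hr).2 fun i => hx (Sum.inl i) trivial)
      (x (Sum.inr ()))
    rw [map_zero, ← this]
    refine congrArg (fun x => MvPolynomial.eval x P) (funext ?_)
    rintro (i | i) <;> rfl

/-- The constancy statement on a convex open set, for values at a generic point `z₀` and any other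
point, obtained by restriction to the line joining them. -/
theorem eq_of_exp_div_eq {ι κ : Type*} [Fintype ι] [Fintype κ] {S : Set (Fin k → ℂ)}
    (hSo : IsOpen S) (hSc : Convex ℝ S) {u : (Fin k → ℂ) → ℂ} {us : ι → (Fin k → ℂ) → ℂ}
    {vs : κ → (Fin k → ℂ) → ℂ} (hu : DifferentiableOn ℂ u S)
    (hus : ∀ j, DifferentiableOn ℂ (us j) S) (hvs : ∀ j, DifferentiableOn ℂ (vs j) S)
    {z₀ w : Fin k → ℂ} (hz₀ : z₀ ∈ S) (hw : w ∈ S) {y₀ : ℂ}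
    {F : MvPolynomial (Fin k ⊕ Unit) ℂ} {Fs : ι → MvPolynomial (Fin k ⊕ Unit) ℂ}
    {Gs : κ → MvPolynomial (Fin k ⊕ Unit) ℂ}
    (hF : MvPolynomial.eval (Sum.elim z₀ fun _ => y₀) F ≠ 0)
    (hFs : ∀ j, MvPolynomial.eval (Sum.elim z₀ fun _ => y₀) (Fs j) ≠ 0)
    (hGs : ∀ j, MvPolynomial.eval (Sum.elim z₀ fun _ => y₀) (Gs j) ≠ 0)
    (hFu : ∀ z ∈ S, MvPolynomial.eval (Sum.elim z fun _ => Complex.exp (u z)) F = 0)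
    (hFus : ∀ j, ∀ z ∈ S, MvPolynomial.eval (Sum.elim z fun _ => Complex.exp (us j z)) (Fs j) = 0)
    (hGvs : ∀ j, ∀ z ∈ S, MvPolynomial.eval (Sum.elim z fun _ => Complex.exp (vs j z)) (Gs j) = 0)
    {μ : ℂ} (hμ : μ ≠ 0) (c : ι → ℂ) (d : κ → ℂ) {P Q : ℂ[X]}
    (hQ : ∀ z ∈ S, eval (Complex.exp (∑ j, c j * us j z)) Q ≠ 0)
    (h : ∀ z ∈ S, Complex.exp (eval (Complex.exp (∑ j, c j * us j z)) P *
      Complex.exp (∑ j, d j * vs j z) / eval (Complex.exp (∑ j, c j * us j z)) Q) =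
        Complex.exp (μ * u z)) :
    u w = u z₀ := by
  set ℓ : ℂ → Fin k → ℂ := fun t => z₀ + t • (w - z₀) with hℓ
  have hℓ0 : ℓ 0 = z₀ := by simp [hℓ]
  have hℓ1 : ℓ 1 = w := by simp [hℓ]
  have hℓd : Differentiable ℂ ℓ := by fun_prop
  have hDo : IsOpen (ℓ ⁻¹' S) := hSo.preimage hℓd.continuous
  have hDc : Convex ℝ (ℓ ⁻¹' S) := by
    intro x hx y hy p q hp hq hpq
    have e : ℓ (p • x + q • y) = p • ℓ x + q • ℓ y := by
      obtain rfl : p = 1 - q := by linarith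
      ext i
      simp [hℓ]
      ring
    rw [Set.mem_preimage, e]
    exact hSc hx hy hp hq hpq
  have h0 : (0 : ℂ) ∈ ℓ ⁻¹' S := by rwa [Set.mem_preimage, hℓ0]
  have h1 : (1 : ℂ) ∈ ℓ ⁻¹' S := by rwa [Set.mem_preimage, hℓ1]
  have han {g : (Fin k → ℂ) → ℂ} (hg : DifferentiableOn ℂ g S) :
      AnalyticOnNhd ℂ (fun t => g (ℓ t)) (ℓ ⁻¹' S) :=
    (hg.comp hℓd.differentiableOn fun _ ht => ht).analyticOnNhd hDo
  have hev : ∀ᶠ t in 𝓝 0, ℓ t ∈ S := hDo.mem_nhds h0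
  have hmem {g : (Fin k → ℂ) → ℂ} (hg : DifferentiableOn ℂ g S)
      {R : MvPolynomial (Fin k ⊕ Unit) ℂ} (hR : MvPolynomial.eval (Sum.elim z₀ fun _ => y₀) R ≠ 0)
      (hRg : ∀ z ∈ S, MvPolynomial.eval (Sum.elim z fun _ => Complex.exp (g z)) R = 0) :
      mk (ofAnalytic _ (han hg 0 h0).cexp) ∈ algGerms :=
    mk_mem_algGerms (v := w - z₀) hR
      ((hev.mono fun t ht => hRg _ ht).filter_mono nhdsWithin_le_nhds)
  have ha : AnalyticAt ℂ (fun t => ∑ j, c j * us j (ℓ t)) 0 :=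
    Finset.analyticAt_fun_sum _ fun j _ => analyticAt_const.mul (han (hus j) 0 h0)
  have hb : AnalyticAt ℂ (fun t => ∑ j, d j * vs j (ℓ t)) 0 :=
    Finset.analyticAt_fun_sum _ fun j _ => analyticAt_const.mul (han (hvs j) 0 h0)
  have key := eventually_eq_of_exp_div_eq hμ ha hb (han hu 0 h0)
    (deriv_mk_sum_mem_algGerms c (fun j => han (hus j) 0 h0)
      (fun j => deriv_mk_mem_algGerms _ (hmem (hus j) (hFs j) (hFus j))) ha)
    (deriv_mk_sum_mem_algGerms d (fun j => han (hvs j) 0 h0)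
      (fun j => deriv_mk_mem_algGerms _ (hmem (hvs j) (hGs j) (hGvs j))) hb)
    (hmem hu hF hFu) (hQ _ h0) (hev.mono fun t ht => h _ ht)
  have := (han hu).eqOn_of_preconnected_of_eventuallyEq analyticOnNhd_const
    hDc.isPreconnected h0 key h1
  simpa only [hℓ0, hℓ1] using this

end Lines

/-- Lemma 2.6, case (9): if `exp{ R(∏_{j≤κ₁} H_j^{μ_j}) · ∏_{j>κ₁} H_j^{μ_j} } = H^μ`
on a connected open set `V ⊆ ℂ^k`, where `H, H₁, …, H_{κ₁+κ₂}` are nowhere vanishing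
Nash algebraic holomorphic functions with chosen holomorphic logarithms `u, u₁, …`,
`μ, μ₁, …` are non-zero reals and `R = P/Q` is a real rational function, then `H` is constant. -/
theorem lemma26_case9
    {k κ₁ κ₂ : ℕ} (V : Set (Fin k → ℂ)) (hVo : IsOpen V) (hVc : IsConnected V)
    (H : (Fin k → ℂ) → ℂ) (Hs : Fin (κ₁ + κ₂) → (Fin k → ℂ) → ℂ)
    (u : (Fin k → ℂ) → ℂ) (us : Fin (κ₁ + κ₂) → (Fin k → ℂ) → ℂ)
    (hH : DifferentiableOn ℂ H V) (hHs : ∀ j, DifferentiableOn ℂ (Hs j) V)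
    (hHn : NashAlgebraicOn H V) (hHsn : ∀ j, NashAlgebraicOn (Hs j) V)
    (hHne : ∀ ξ ∈ V, H ξ ≠ 0) (hHsne : ∀ j, ∀ ξ ∈ V, Hs j ξ ≠ 0)
    (hu : DifferentiableOn ℂ u V) (hus : ∀ j, DifferentiableOn ℂ (us j) V)
    (hexpu : ∀ ξ ∈ V, Complex.exp (u ξ) = H ξ)
    (hexpus : ∀ j, ∀ ξ ∈ V, Complex.exp (us j ξ) = Hs j ξ)
    (μ : ℝ) (μs : Fin (κ₁ + κ₂) → ℝ) (hμ : μ ≠ 0) (hμs : ∀ j, μs j ≠ 0)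
    (P Q : Polynomial ℝ)
    (A B : (Fin k → ℂ) → ℂ)
    (hA : ∀ ξ, A ξ =
      Complex.exp (∑ j : Fin κ₁, (μs (Fin.castAdd κ₂ j) : ℂ) * us (Fin.castAdd κ₂ j) ξ))
    (hB : ∀ ξ, B ξ =
      Complex.exp (∑ j : Fin κ₂, (μs (Fin.natAdd κ₁ j) : ℂ) * us (Fin.natAdd κ₁ j) ξ))
    (hQA : ∀ ξ ∈ V, Polynomial.aeval (A ξ) Q ≠ 0)
    (heq : ∀ ξ ∈ V,
      Complex.exp (Polynomial.aeval (A ξ) P * B ξ / Polynomial.aeval (A ξ) Q) =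
        Complex.exp ((μ : ℂ) * u ξ)) :
    ∃ c : ℂ, ∀ ξ ∈ V, H ξ = c := by
  choose F hF hFH using hHn
  choose Fs hFs hFHs using hHsn
  refine hVo.exists_is_const_of_fderiv_eq_zero hVc.isPreconnected hH fun z hz => ?_
  obtain ⟨r, hr, hrV⟩ := Metric.isOpen_iff.1 hVo z hz
  obtain ⟨z₀, hz₀, y₀, hy₀⟩ := exists_eval_sumElim_ne_zero
    (mul_ne_zero hF (Finset.prod_ne_zero_iff.2 fun j _ => hFs j : ∏ j, Fs j ≠ 0)) (z := z) hr
  rw [map_mul, map_prod, mul_ne_zero_iff, Finset.prod_ne_zero_iff] at hy₀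
  have haeval (x : ℂ) (R : Polynomial ℝ) :
      (R.map (algebraMap ℝ ℂ)).eval x = Polynomial.aeval x R := Polynomial.eval_map_algebraMap R x
  have hconst (w : Fin k → ℂ) (hw : w ∈ Metric.ball z r) : H w = H z₀ := by
    rw [← hexpu w (hrV hw), ← hexpu z₀ (hrV hz₀)]
    refine congrArg Complex.exp (eq_of_exp_div_eq Metric.isOpen_ball (convex_ball z r)
      (hu.mono hrV) (fun j => (hus (Fin.castAdd κ₂ j)).mono hrV)
      (fun j => (hus (Fin.natAdd κ₁ j)).mono hrV) hz₀ hw hy₀.1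
      (fun j => hy₀.2 (Fin.castAdd κ₂ j) (Finset.mem_univ _))
      (fun j => hy₀.2 (Fin.natAdd κ₁ j) (Finset.mem_univ _)) (fun x hx => ?_) (fun j x hx => ?_)
      (fun j x hx => ?_) (Complex.ofReal_ne_zero.2 hμ) (fun j => μs (Fin.castAdd κ₂ j))
      (fun j => μs (Fin.natAdd κ₁ j)) (P := P.map (algebraMap ℝ ℂ)) (Q := Q.map (algebraMap ℝ ℂ))
      (fun x hx => ?_) fun x hx => ?_)
    · rw [hexpu x (hrV hx)]
      exact hFH x (hrV hx)
    · rw [hexpus _ x (hrV hx)]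
      exact hFHs _ x (hrV hx)
    · rw [hexpus _ x (hrV hx)]
      exact hFHs _ x (hrV hx)
    · rw [haeval, ← hA]
      exact hQA x (hrV hx)
    · rw [haeval, haeval, ← hA, ← hB]
      exact heq x (hrV hx)
  have : H =ᶠ[nhds z] fun _ => H z₀ :=
    Filter.eventually_of_mem (Metric.ball_mem_nhds z hr) hconst
  rw [this.fderiv_eq]
  exact fderiv_const_apply _
end

section
/- Let V ⊆ ℂ^k be a connected open set and let F and G be Nash algebraic holomorphic functions on V such that exp(F(ξ)) = G(ξ) for all ξ ∈ V. Then F is constant on V. (Special case of Lemma 2.6: the exponential of a non-constant Nash algebraic holomorphic function is never Nash algebraic, since an exponential grows faster at infinity than any algebraic function.) -/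
open MvPolynomial Algebra in
/-- For `x` transcendental, `x, y` are algebraically independent iff `y` is transcendental
over `R[x]`. -/
theorem algebraicIndependent_pair_iff {R A : Type*} [CommRing R] [CommRing A] [Algebra R A]
    {x y : A} (hx : Transcendental R x) :
    AlgebraicIndependent R ![x, y] ↔ Transcendental (adjoin R {x}) y := by
  rw [AlgebraicIndependent.iff_transcendental_adjoin_image 1]
  have himage : ![x, y] '' {1}ᶜ = {x} := by
    ext a
    simp [Fin.exists_fin_two, eq_comm]
  have hsub : Subsingleton {j : Fin 2 // j ≠ 1} := ⟨by decide⟩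
  rw [himage, algebraicIndependent_singleton_iff (⟨0, by decide⟩ : {j : Fin 2 // j ≠ 1})]
  simp [hx]

theorem algebraicIndependent_pair_comm {R A : Type*} [CommRing R] [CommRing A] [Algebra R A]
    {x y : A} : AlgebraicIndependent R ![x, y] ↔ AlgebraicIndependent R ![y, x] := by
  refine algebraicIndependent_equiv' (Equiv.swap 0 1) ?_
  ext i
  fin_cases i <;> simp

/-- Algebraic dependence of pairs of transcendental elements of a domain is transitive. -/
theorem not_algebraicIndependent_pair_trans {R A : Type*} [CommRing R] [CommRing A] [IsDomain A]
    [Algebra R A] {f t g : A} (hf : Transcendental R f) (ht : Transcendental R t)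
    (htf : ¬ AlgebraicIndependent R ![t, f]) (htg : ¬ AlgebraicIndependent R ![t, g]) :
    ¬ AlgebraicIndependent R ![f, g] := by
  rw [algebraicIndependent_pair_comm, algebraicIndependent_pair_iff hf, Transcendental,
    not_not] at htf
  rw [algebraicIndependent_pair_iff ht, Transcendental, not_not] at htg
  rw [algebraicIndependent_pair_iff hf, Transcendental, not_not]
  refine htg.adjoin_of_forall_isAlgebraic ?_
  rintro _ ⟨rfl, -⟩
  exact htf

theorem MvPolynomial.map_aeval_eq_eval {σ S R : Type*} [CommSemiring R] [CommSemiring S]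
    [Algebra R S] (φ : S →ₐ[R] R) (x : σ → S) (p : MvPolynomial σ R) :
    φ (aeval x p) = eval (fun i => φ (x i)) p := by
  rw [comp_aeval_apply]
  rfl

/-- The functions `w` and `exp w` are algebraically independent on any nonempty open set. -/
theorem MvPolynomial.eq_zero_of_eval_exp_eq_zero {W : Set ℂ} (hWo : IsOpen W)
    (hWne : W.Nonempty) {R : MvPolynomial (Fin 2) ℂ}
    (hR : ∀ w ∈ W, eval ![w, Complex.exp w] R = 0) : R = 0 := by
  have hentire : AnalyticOnNhd ℂ (fun w : ℂ => eval ![w, Complex.exp w] R) Set.univ := by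
    simp_rw [← MvPolynomial.coe_aeval_eq_eval]
    refine AnalyticOnNhd.aeval_mvPolynomial (f := fun w : ℂ => ![w, Complex.exp w]) ?_ R
    intro i
    fin_cases i
    · exact analyticOnNhd_id
    · exact analyticOnNhd_cexp
  obtain ⟨w₀, hw₀⟩ := hWne
  have hzero : ∀ w : ℂ, eval ![w, Complex.exp w] R = 0 := fun w =>
    hentire.eqOn_zero_of_preconnected_of_eventuallyEq_zero isPreconnected_univ
      (Set.mem_univ w₀) (Filter.eventually_of_mem (hWo.mem_nhds hw₀) hR) (Set.mem_univ w)
  have hslice : ∀ x y : ℂ, y ≠ 0 → eval ![x, y] R = 0 := by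
    intro x y hy
    let p : Polynomial ℂ := aeval ![Polynomial.X, Polynomial.C y] R
    have hp : ∀ z, p.eval z = eval ![z, y] R := by
      intro z
      rw [← Polynomial.coe_aeval_eq_eval]
      refine (map_aeval_eq_eval (Polynomial.aeval z) _ R).trans
        (congrArg (eval · R) (_root_.funext fun i => ?_))
      fin_cases i <;> simp
    have hp0 : p = 0 := by
      refine Polynomial.eq_zero_of_infinite_isRoot p
        ((Set.infinite_range_of_injective
          (f := fun n : ℤ => Complex.log y + n * (2 * Real.pi * Complex.I)) ?_).mono ?_)
      · intro m n hmn
        simpa [Complex.two_pi_I_ne_zero] using hmn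
      · rintro _ ⟨n, rfl⟩
        have := hzero (Complex.log y + n * (2 * Real.pi * Complex.I))
        rw [Complex.exp_periodic.int_mul n (Complex.log y), Complex.exp_log hy] at this
        simpa [Polynomial.IsRoot, hp] using this
    rw [← hp, hp0, Polynomial.eval_zero]
  refine MvPolynomial.funext_set ![Set.univ, {0}ᶜ] ?_ ?_
  · intro i
    fin_cases i
    · exact Set.infinite_univ
    · exact (Set.finite_singleton (0 : ℂ)).infinite_compl
  · intro x hx
    rw [map_zero, ← hslice (x 0) (x 1) (by simpa using hx 1 trivial)]
    refine congrArg (eval · R) (_root_.funext fun i => ?_)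
    fin_cases i <;> rfl

/-- The algebra of functions on `U ⊆ ℂ` that are restrictions of functions analytic on `U`. -/
def analyticSubalgebra (U : Set ℂ) : Subalgebra ℂ (U → ℂ) where
  carrier := {h | ∃ H : ℂ → ℂ, AnalyticOnNhd ℂ H U ∧ U.domRestrict H = h}
  mul_mem' := by
    rintro _ _ ⟨H, hH, rfl⟩ ⟨K, hK, rfl⟩
    exact ⟨H * K, hH.mul hK, rfl⟩
  add_mem' := by
    rintro _ _ ⟨H, hH, rfl⟩ ⟨K, hK, rfl⟩
    exact ⟨H + K, hH.add hK, rfl⟩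
  algebraMap_mem' c := ⟨fun _ => c, analyticOnNhd_const, rfl⟩

theorem isDomain_analyticSubalgebra {U : Set ℂ} (hUc : IsConnected U) :
    IsDomain (analyticSubalgebra U) := by
  have : Nonempty U := hUc.nonempty.to_subtype
  have : NoZeroDivisors (analyticSubalgebra U) := by
    refine ⟨?_⟩
    rintro ⟨_, H, hH, rfl⟩ ⟨_, K, hK, rfl⟩ h
    have hmul : ∀ z ∈ U, H z * K z = 0 := fun z hz =>
      congrFun (congrArg Subtype.val h) ⟨z, hz⟩
    exact (AnalyticOnNhd.eq_zero_or_eq_zero_of_mul_eq_zero hH hK hmul hUc.isPreconnected).imp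
      (fun h => Subtype.ext (funext fun u => h u u.2))
      (fun h => Subtype.ext (funext fun u => h u u.2))
  exact NoZeroDivisors.to_isDomain _

/-- Evaluation at a point of `U`, as an algebra homomorphism. -/
def analyticSubalgebraEval {U : Set ℂ} (u : U) : analyticSubalgebra U →ₐ[ℂ] ℂ :=
  (Pi.evalAlgHom ℂ (fun _ : U => ℂ) u).comp (analyticSubalgebra U).val

@[simp]
theorem analyticSubalgebraEval_apply {U : Set ℂ} (u : U) (h : analyticSubalgebra U) :
    analyticSubalgebraEval u h = h.1 u := rfl

theorem analyticSubalgebra_aeval_pair {U : Set ℂ} (x y : analyticSubalgebra U)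
    (p : MvPolynomial (Fin 2) ℂ) (u : U) :
    (MvPolynomial.aeval ![x, y] p).1 u = MvPolynomial.eval ![x.1 u, y.1 u] p := by
  refine (MvPolynomial.map_aeval_eq_eval (analyticSubalgebraEval u) _ p).trans
    (congrArg (MvPolynomial.eval · p) (_root_.funext fun i => ?_))
  fin_cases i <;> rfl

theorem not_algebraicIndependent_analyticSubalgebra {U : Set ℂ} {x y : analyticSubalgebra U}
    {p : MvPolynomial (Fin 2) ℂ} (hp : p ≠ 0)
    (h : ∀ u, MvPolynomial.eval ![x.1 u, y.1 u] p = 0) :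
    ¬ AlgebraicIndependent ℂ ![x, y] := fun hind =>
  hp <| algebraicIndependent_iff.1 hind p <| Subtype.ext <| funext fun u =>
    (analyticSubalgebra_aeval_pair x y p u).trans (h u)

theorem transcendental_analyticSubalgebra {U : Set ℂ} {x : analyticSubalgebra U}
    (hx : (Set.range x.1).Infinite) : Transcendental ℂ x := by
  rw [transcendental_iff]
  intro p hp
  refine Polynomial.eq_zero_of_infinite_isRoot p (hx.mono ?_)
  rintro _ ⟨u, rfl⟩
  have := congrArg (analyticSubalgebraEval u) hp
  rwa [← Polynomial.aeval_algHom_apply, map_zero, Polynomial.coe_aeval_eq_eval] at this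

/-- The one-variable case, for algebraic functions on a connected open subset of `ℂ`. -/
theorem eqOn_const_of_algebraic_of_exp_algebraic {U : Set ℂ} (hUo : IsOpen U)
    (hUc : IsConnected U) {f g : ℂ → ℂ} (hf : AnalyticOnNhd ℂ f U) (hg : AnalyticOnNhd ℂ g U)
    (hexp : ∀ t ∈ U, Complex.exp (f t) = g t) {p q : MvPolynomial (Fin 2) ℂ} (hp : p ≠ 0)
    (hq : q ≠ 0) (hpf : ∀ t ∈ U, MvPolynomial.eval ![t, f t] p = 0)
    (hqg : ∀ t ∈ U, MvPolynomial.eval ![t, g t] q = 0) :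
    ∃ w, ∀ t ∈ U, f t = w := by
  refine (hf.is_constant_or_isOpen hUc.isPreconnected).resolve_right fun hopen => ?_
  have hfU : IsOpen (f '' U) := hopen U subset_rfl hUo
  have hfne : (f '' U).Nonempty := hUc.nonempty.image f
  have := isDomain_analyticSubalgebra hUc
  obtain ⟨T, hT⟩ : ∃ T : analyticSubalgebra U, ∀ u, T.1 u = u :=
    ⟨⟨_, id, analyticOnNhd_id, rfl⟩, fun _ => rfl⟩
  obtain ⟨f', hf'⟩ : ∃ f' : analyticSubalgebra U, ∀ u, f'.1 u = f u :=
    ⟨⟨_, f, hf, rfl⟩, fun _ => rfl⟩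
  obtain ⟨g', hg'⟩ : ∃ g' : analyticSubalgebra U, ∀ u, g'.1 u = g u :=
    ⟨⟨_, g, hg, rfl⟩, fun _ => rfl⟩
  have hTtr : Transcendental ℂ T := transcendental_analyticSubalgebra <| by
    refine (infinite_of_mem_nhds _ (hUo.mem_nhds hUc.nonempty.some_mem)).mono ?_
    exact fun t ht => ⟨⟨t, ht⟩, hT _⟩
  have hftr : Transcendental ℂ f' := transcendental_analyticSubalgebra <| by
    refine (infinite_of_mem_nhds _ (hfU.mem_nhds hfne.some_mem)).mono ?_
    rintro _ ⟨t, ht, rfl⟩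
    exact ⟨⟨t, ht⟩, hf' _⟩
  refine not_algebraicIndependent_pair_trans (g := g') hftr hTtr
    (not_algebraicIndependent_analyticSubalgebra hp fun u => by rw [hT, hf', hpf u u.2])
    (not_algebraicIndependent_analyticSubalgebra hq fun u => by rw [hT, hg', hqg u u.2]) ?_
  rw [algebraicIndependent_iff]
  intro R hR
  refine MvPolynomial.eq_zero_of_eval_exp_eq_zero hfU hfne ?_
  rintro _ ⟨t, ht, rfl⟩
  have hRt := analyticSubalgebra_aeval_pair f' g' R ⟨t, ht⟩
  rw [hf', hg', hR] at hRt
  rw [hexp t ht]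
  exact hRt.symm

/-- A nonzero polynomial in `(z, y)` stays nonzero at `z`, for all `z` off the zero set of some
nonzero polynomial. -/
theorem MvPolynomial.exists_ne_zero_forall_exists_eval_ne_zero {σ : Type*}
    {P : MvPolynomial (σ ⊕ Unit) ℂ} (hP : P ≠ 0) :
    ∃ Q : MvPolynomial σ ℂ, Q ≠ 0 ∧
      ∀ z, eval z Q ≠ 0 → ∃ y : ℂ, eval (Sum.elim z fun _ => y) P ≠ 0 := by
  obtain ⟨x, hx⟩ : ∃ x, eval x P ≠ 0 := by
    by_contra! h
    exact hP (MvPolynomial.funext fun x => by rw [h, map_zero])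
  have heval : ∀ z, eval z (aeval (Sum.elim X fun _ => C (x (Sum.inr ()))) P) =
      eval (Sum.elim z fun _ => x (Sum.inr ())) P := by
    intro z
    refine (map_aeval_eq_eval (aeval z) _ P).trans (congrArg (eval · P) (_root_.funext fun i => ?_))
    rcases i with i | i <;> simp
  refine ⟨_, fun h => hx ?_, fun z hz => ⟨_, (heval z) ▸ hz⟩⟩
  have hx0 := heval (fun i => x (Sum.inl i))
  rw [h, map_zero] at hx0
  rw [hx0]
  refine congrArg (eval · P) (_root_.funext fun i => ?_)
  rcases i with i | i <;> rfl

/-- A nonzero polynomial does not vanish identically on a nonempty open set. -/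
theorem MvPolynomial.exists_eval_ne_zero_of_isOpen {σ : Type*} [Finite σ]
    {Q : MvPolynomial σ ℂ} (hQ : Q ≠ 0) {B : Set (σ → ℂ)} (hB : IsOpen B) (hne : B.Nonempty) :
    ∃ z ∈ B, eval z Q ≠ 0 := by
  by_contra! h
  obtain ⟨a, ha⟩ := hne
  obtain ⟨u, hu, hsub⟩ := isOpen_pi_iff'.1 hB a ha
  exact hQ (MvPolynomial.funext_set u
    (fun i => infinite_of_mem_nhds (a i) ((hu i).1.mem_nhds (hu i).2))
    fun z hz => by rw [h z (hsub hz), map_zero])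

/-- Restriction of a polynomial relation to the line through `a` with direction `v`. -/
theorem MvPolynomial.exists_line_restriction {σ : Type*} {P : MvPolynomial (σ ⊕ Unit) ℂ}
    {a : σ → ℂ} (ha : ∃ y : ℂ, eval (Sum.elim a fun _ => y) P ≠ 0) (v : σ → ℂ) :
    ∃ p : MvPolynomial (Fin 2) ℂ, p ≠ 0 ∧
      ∀ t y : ℂ, eval ![t, y] p = eval (Sum.elim (a + t • v) fun _ => y) P := by
  have heval : ∀ t y : ℂ,
      eval ![t, y] (aeval (Sum.elim (fun i => C (a i) + X 0 * C (v i)) fun _ => X 1) P) =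
        eval (Sum.elim (a + t • v) fun _ => y) P := by
    intro t y
    refine (map_aeval_eq_eval (aeval ![t, y]) _ P).trans
      (congrArg (eval · P) (_root_.funext fun i => ?_))
    rcases i with i | i <;> simp
  obtain ⟨y, hy⟩ := ha
  refine ⟨_, fun h => hy ?_, heval⟩
  have := heval 0 y
  rwa [h, map_zero, zero_smul, add_zero, eq_comm] at this

/-- If `F` and `G` are Nash algebraic holomorphic functions on a connected open set
`V ⊆ ℂ^k` with `exp (F ξ) = G ξ` on `V`, then `F` is constant on `V`. -/
theorem exp_of_nashAlgebraic_eq_nashAlgebraic_constant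
    {k : ℕ} (V : Set (Fin k → ℂ)) (hVo : IsOpen V) (hVc : IsConnected V)
    (F G : (Fin k → ℂ) → ℂ)
    (hF : DifferentiableOn ℂ F V) (hG : DifferentiableOn ℂ G V)
    (hFn : NashAlgebraicOn F V) (hGn : NashAlgebraicOn G V)
    (hexp : ∀ ξ ∈ V, Complex.exp (F ξ) = G ξ) :
    ∃ c : ℂ, ∀ ξ ∈ V, F ξ = c := by
  obtain ⟨P, hP, hPF⟩ := hFn
  obtain ⟨Q, hQ, hQG⟩ := hGn
  obtain ⟨P', hP', hPP'⟩ := MvPolynomial.exists_ne_zero_forall_exists_eval_ne_zero hP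
  obtain ⟨Q', hQ', hQQ'⟩ := MvPolynomial.exists_ne_zero_forall_exists_eval_ne_zero hQ
  have hlocal : ∀ x ∈ V, ∃ r > 0, ∃ c, ∀ z ∈ Metric.ball x r, F z = c := by
    intro x hx
    obtain ⟨r, hr, hball⟩ := Metric.isOpen_iff.1 hVo x hx
    refine ⟨r, hr, ?_⟩
    obtain ⟨a, ha, hne⟩ := MvPolynomial.exists_eval_ne_zero_of_isOpen (mul_ne_zero hP' hQ')
      (Metric.isOpen_ball (x := x) (ε := r)) ⟨x, Metric.mem_ball_self hr⟩
    rw [map_mul, mul_ne_zero_iff] at hne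
    refine ⟨F a, fun b hb => ?_⟩
    obtain ⟨p, hp, hpe⟩ := MvPolynomial.exists_line_restriction (hPP' a hne.1) (b - a)
    obtain ⟨q, hq, hqe⟩ := MvPolynomial.exists_line_restriction (hQQ' a hne.2) (b - a)
    let l : ℂ → Fin k → ℂ := fun t => a + t • (b - a)
    have hl : Differentiable ℂ l := by fun_prop
    let U : Set ℂ := l ⁻¹' Metric.ball x r
    have hUo : IsOpen U := Metric.isOpen_ball.preimage hl.continuous
    have h0 : (0 : ℂ) ∈ U := by simpa [U, l] using ha
    have h1 : (1 : ℂ) ∈ U := by simpa [U, l] using hb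
    have hUconv : Convex ℝ U := by
      intro s hs t ht α β hα hβ hαβ
      have hline : l (α • s + β • t) = α • l s + β • l t := by
        have hαβ' : (α : ℂ) + β = 1 := by exact_mod_cast hαβ
        ext i
        simp only [l, Pi.add_apply, Pi.smul_apply, Pi.sub_apply, Complex.real_smul, smul_eq_mul]
        linear_combination (-a i) * hαβ'
      change l _ ∈ Metric.ball x r
      rw [hline]
      exact convex_ball x r hs ht hα hβ hαβ
    have hUV : ∀ t ∈ U, l t ∈ V := fun t ht => hball ht
    obtain ⟨w, hw⟩ := eqOn_const_of_algebraic_of_exp_algebraic hUo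
      ⟨⟨0, h0⟩, hUconv.isPreconnected⟩ (f := F ∘ l) (g := G ∘ l)
      ((hF.comp hl.differentiableOn hUV).analyticOnNhd hUo)
      ((hG.comp hl.differentiableOn hUV).analyticOnNhd hUo)
      (fun t ht => hexp _ (hUV t ht)) hp hq
      (fun t ht => (hpe _ _).trans (hPF _ (hUV t ht)))
      (fun t ht => (hqe _ _).trans (hQG _ (hUV t ht)))
    simpa [l] using (hw 1 h1).trans (hw 0 h0).symm
  have : ConnectedSpace V := isConnected_iff_connectedSpace.1 hVc
  have hconst : IsLocallyConstant (V.domRestrict F) := by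
    rw [IsLocallyConstant.iff_eventually_eq]
    intro x
    obtain ⟨r, hr, c, hc⟩ := hlocal x x.2
    filter_upwards [(continuous_subtype_val (p := (· ∈ V))).continuousAt.preimage_mem_nhds
      (Metric.ball_mem_nhds (x : Fin k → ℂ) hr)] with z hz
    exact (hc z hz).trans (hc x (Metric.mem_ball_self hr)).symm
  obtain ⟨c, hc⟩ := hconst.exists_eq_const
  exact ⟨c, fun ξ hξ => congrFun hc ⟨ξ, hξ⟩⟩
end

section
/- Let U ⊆ ℂ^N be a connected open neighborhood of 0, let g_1, …, g_n be holomorphic functions on U that are linearly independent over ℂ, and let ε_1, …, ε_n ∈ {+1, −1}. Let U' be a neighborhood of 0 in ℂ^N such that the conjugate functions \bar{g}_j(w) := \overline{g_j(\bar{w})} are defined and holomorphic on U', and define G(z, w) = Σ_{j=1}^n ε_j g_j(z) \bar{g}_j(w) for (z, w) ∈ U × U'. Suppose that for every multi-index β ∈ ℕ^N the function z ↦ (∂_w^β G)(z, 0) is a polynomial function of z. Then each g_j is (the restriction to U of) a polynomial. (Key step in the proof of Theorem 2.1(i): each g_j is a linear combination of the w-derivative coefficient functions of G at w = 0.) -/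
open Metric Filter Topology

section SeveralComplexVariables

variable {E : Type*} [NormedAddCommGroup E] [NormedSpace ℂ E] {f : E → ℂ} {U : Set E}

lemma circleIntegral_comp_line_eq_fderiv {z v : E} {ρ : ℝ} (hρ : 0 < ρ)
    (hU : IsOpen U) (hf : DifferentiableOn ℂ f U) (hz : ∀ ζ ∈ closedBall (0 : ℂ) ρ, z + ζ • v ∈ U) :
    ∮ ζ in C(0, ρ), (1 / (ζ - 0) ^ 2) • f (z + ζ • v)
      = (2 * Real.pi * Complex.I) • fderiv ℂ f z v := by
  have hline : Differentiable ℂ fun ζ : ℂ => z + ζ • v := by fun_prop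
  have hd : DifferentiableOn ℂ (fun ζ : ℂ => f (z + ζ • v)) (closedBall 0 ρ) :=
    hf.comp hline.differentiableOn hz
  rw [hd.deriv_eq_smul_circleIntegral hρ]
  congr 1
  have hzU : z + (0 : ℂ) • v ∈ U := hz 0 (mem_closedBall_self hρ.le)
  have hfz : HasFDerivAt f (fderiv ℂ f z) (z + (0 : ℂ) • v) := by
    have := (hf.differentiableAt (hU.mem_nhds hzU)).hasFDerivAt
    simpa using this
  have hlz : HasDerivAt (fun ζ : ℂ => z + ζ • v) v 0 := by
    simpa using ((hasDerivAt_id (0 : ℂ)).smul_const v).const_add z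
  exact (hfz.comp_hasDerivAt (0 : ℂ) hlz).deriv

variable [FiniteDimensional ℂ E]

/-- Directional derivatives of holomorphic functions are holomorphic. -/
lemma DifferentiableOn.fderiv_apply_of_isOpen (hU : IsOpen U) (hf : DifferentiableOn ℂ f U)
    (v : E) : DifferentiableOn ℂ (fun z => fderiv ℂ f z v) U := by
  intro z₀ hz₀
  have : ProperSpace E := FiniteDimensional.proper ℂ E
  obtain ⟨R, hR, hRU⟩ := nhds_basis_closedBall.mem_iff.mp (hU.mem_nhds hz₀)
  set r := R / 3 with hr
  have hr0 : 0 < r := by positivity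
  obtain ⟨C, hC⟩ := (isCompact_closedBall z₀ R).exists_bound_of_continuousOn
    (hf.continuousOn.mono hRU)
  set ρ := r / (‖v‖ + 1) with hρdef
  have hρ : 0 < ρ := by positivity
  have hρv : ∀ ζ ∈ closedBall (0 : ℂ) ρ, ‖ζ • v‖ ≤ r := by
    intro ζ hζ
    rw [norm_smul]
    have h1 : ‖ζ‖ ≤ ρ := by simpa using hζ
    calc ‖ζ‖ * ‖v‖ ≤ ρ * (‖v‖ + 1) := by gcongr; linarith
      _ = r := by rw [hρdef]; field_simp
  have hnear : ∀ z ∈ ball z₀ r, ∀ ζ ∈ closedBall (0 : ℂ) ρ,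
      z + ζ • v ∈ closedBall z₀ (2 * r) := by
    intro z hz ζ hζ
    rw [mem_closedBall, dist_eq_norm, show z + ζ • v - z₀ = (z - z₀) + ζ • v by abel]
    rw [mem_ball, dist_eq_norm] at hz
    linarith [norm_add_le (z - z₀) (ζ • v), hρv ζ hζ]
  have hsub : closedBall z₀ (2 * r) ⊆ U :=
    (closedBall_subset_closedBall (by linarith)).trans hRU
  have hbound : ∀ x ∈ closedBall z₀ (2 * r), ‖fderiv ℂ f x‖ ≤ (2 * C) / r := by
    intro x hx
    have hxR : ball x r ⊆ closedBall z₀ R := by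
      intro y hy
      rw [mem_closedBall] at hx ⊢
      rw [mem_ball] at hy
      linarith [dist_triangle y x z₀]
    refine Complex.norm_fderiv_le_div_of_mapsTo_ball (hf.mono (hxR.trans hRU)) ?_ hr0
    intro y hy
    rw [mem_closedBall, dist_eq_norm]
    linarith [norm_sub_le (f y) (f x), hC y (hxR hy), hC x (hxR (mem_ball_self hr0))]
  have hcirc : ∀ θ : ℝ, circleMap (0 : ℂ) ρ θ ∈ closedBall (0 : ℂ) ρ := fun θ =>
    circleMap_mem_closedBall 0 hρ.le θ
  set k : ℝ → ℂ := fun θ => _root_.deriv (circleMap 0 ρ) θ * (1 / (circleMap 0 ρ θ - 0) ^ 2) with hk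
  have hkc : Continuous k := by
    have h0 : ∀ θ, (circleMap 0 ρ θ - 0) ^ 2 ≠ 0 := fun θ =>
      pow_ne_zero _ (sub_ne_zero.mpr (circleMap_ne_center hρ.ne'))
    simp only [hk, deriv_circleMap]
    have := continuous_circleMap (0 : ℂ) ρ
    fun_prop (disch := exact h0 _)
  have hFc : ∀ z ∈ ball z₀ r, Continuous fun θ : ℝ => k θ * f (z + circleMap 0 ρ θ • v) := by
    intro z hz
    refine hkc.mul (hf.continuousOn.comp_continuous ?_ fun θ => hsub (hnear z hz _ (hcirc θ)))
    have := continuous_circleMap (0 : ℂ) ρ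
    fun_prop
  have hint := intervalIntegral.hasFDerivAt_integral_of_dominated_of_fderiv_le
    (𝕜 := ℂ) (μ := MeasureTheory.volume) (a := 0) (b := 2 * Real.pi)
    (F := fun z θ => k θ * f (z + circleMap 0 ρ θ • v))
    (F' := fun z θ => k θ • fderiv ℂ f (z + circleMap 0 ρ θ • v))
    (x₀ := z₀) (s := ball z₀ r) (bound := fun θ => ‖k θ‖ * (2 * C / r))
    (ball_mem_nhds z₀ hr0)
    (by
      filter_upwards [ball_mem_nhds z₀ hr0] with z hz
      exact (hFc z hz).aestronglyMeasurable)
    ((hFc z₀ (mem_ball_self hr0)).intervalIntegrable _ _)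
    (by
      borelize E
      have hm : Measurable fun θ : ℝ => fderiv ℂ f (z₀ + circleMap 0 ρ θ • v) := by
        refine (measurable_fderiv ℂ f).comp (Continuous.measurable ?_)
        have := continuous_circleMap (0 : ℂ) ρ
        fun_prop
      exact hkc.aestronglyMeasurable.smul hm.aestronglyMeasurable)
    (by
      refine Eventually.of_forall fun θ _ z hz => ?_
      rw [norm_smul]
      exact mul_le_mul_of_nonneg_left (hbound _ (hnear z hz _ (hcirc θ))) (norm_nonneg _))
    ((hkc.norm.mul continuous_const).intervalIntegrable _ _)
    (by
      refine Eventually.of_forall fun θ _ z hz => ?_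
      have h1 := (hf.differentiableAt
        (hU.mem_nhds (hsub (hnear z hz _ (hcirc θ))))).hasFDerivAt
      exact ((hasFDerivAt_comp_add_right _).mpr h1).const_mul (k θ))
  have hd := hint.differentiableAt.const_smul (2 * Real.pi * Complex.I : ℂ)⁻¹
  refine (hd.congr_of_eventuallyEq ?_).differentiableWithinAt
  filter_upwards [ball_mem_nhds z₀ hr0] with z hz
  have h := circleIntegral_comp_line_eq_fderiv (z := z) (v := v) hρ hU hf
    fun ζ hζ => hsub (hnear z hz ζ hζ)
  rw [Pi.smul_apply, eq_inv_smul_iff₀ Complex.two_pi_I_ne_zero, ← h, circleIntegral]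
  simp only [hk, smul_eq_mul, mul_assoc]

/-- Holomorphic functions of several variables are smooth. -/
lemma DifferentiableOn.contDiffOn_of_finiteDimensional (hU : IsOpen U)
    (hf : DifferentiableOn ℂ f U) (n : ℕ) : ContDiffOn ℂ n f U := by
  induction n generalizing f with
  | zero => exact contDiffOn_zero.mpr hf.continuousOn
  | succ n ih =>
    push_cast
    rw [contDiffOn_succ_iff_fderiv_of_isOpen hU, contDiffOn_clm_apply]
    exact ⟨hf, fun h => by simp at h, fun v => ih (hf.fderiv_apply_of_isOpen hU v)⟩

/-- A holomorphic function whose derivatives of all orders vanish at `0` vanishes near `0`. -/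
lemma DifferentiableOn.eventuallyEq_zero_of_iteratedFDeriv_eq_zero (hU : IsOpen U)
    (h0 : (0 : E) ∈ U) (hf : DifferentiableOn ℂ f U) (hd : ∀ k, iteratedFDeriv ℂ k f 0 = 0) :
    f =ᶠ[𝓝 0] 0 := by
  obtain ⟨r, hr, hrU⟩ := Metric.isOpen_iff.mp hU 0 h0
  filter_upwards [ball_mem_nhds (0 : E) hr] with z hz
  obtain ⟨s, hzs, hsr⟩ := exists_between (mem_ball_zero_iff.mp hz)
  have hs : 0 < s := (norm_nonneg z).trans_lt hzs
  let L : ℂ →L[ℂ] E := ContinuousLinearMap.toSpanSingleton ℂ z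
  have hLU : IsOpen (L ⁻¹' U) := hU.preimage L.continuous
  have hL0 : L 0 ∈ U := by simpa using h0
  have hball : ball (0 : ℂ) (r / s) ⊆ L ⁻¹' U := by
    intro t ht
    apply hrU
    rw [mem_ball_zero_iff] at ht ⊢
    rw [lt_div_iff₀ hs] at ht
    simp only [L, ContinuousLinearMap.toSpanSingleton_apply, norm_smul]
    exact (mul_le_mul_of_nonneg_left hzs.le (norm_nonneg t)).trans_lt ht
  have hfL : DifferentiableOn ℂ (f ∘ L) (L ⁻¹' U) :=
    hf.comp L.differentiable.differentiableOn fun _ h => h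
  have hzero : ∀ k, iteratedDeriv k (f ∘ L) 0 = 0 := by
    intro k
    rw [iteratedDeriv_eq_iteratedFDeriv, ← iteratedFDerivWithin_of_isOpen k hLU hL0,
      L.iteratedFDerivWithin_comp_right (hf.contDiffOn_of_finiteDimensional hU k)
        hU.uniqueDiffOn hLU.uniqueDiffOn hL0 le_rfl,
      iteratedFDerivWithin_of_isOpen k hU hL0, map_zero, hd k]
    simp
  have h1 : (1 : ℂ) ∈ ball (0 : ℂ) (r / s) := by
    rw [mem_ball_zero_iff, norm_one, lt_div_iff₀ hs, one_mul]
    exact hsr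
  have hsum := Complex.hasSum_taylorSeries_on_ball (hfL.mono hball) h1
  simp only [hzero, smul_zero] at hsum
  simpa [L] using hsum.unique hasSum_zero

omit [FiniteDimensional ℂ E] in
/-- The identity theorem for holomorphic functions of several variables. -/
lemma DifferentiableOn.eqOn_zero_of_isPreconnected (hU : IsOpen U) (hUc : IsPreconnected U)
    (hf : DifferentiableOn ℂ f U) {x₀ : E} (hx₀ : x₀ ∈ U) (h : f =ᶠ[𝓝 x₀] 0) :
    ∀ z ∈ U, f z = 0 := by
  have hZ : IsOpen {x | f =ᶠ[𝓝 x] 0} := isOpen_setOfPred_eventually_nhds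
  have hsub : U ⊆ {x | f =ᶠ[𝓝 x] 0} := by
    refine hUc.subset_of_closure_inter_subset hZ ⟨x₀, hx₀, h⟩ ?_
    rintro x ⟨hxZ, hxU⟩
    obtain ⟨r, hr, hrU⟩ := Metric.isOpen_iff.mp hU x hxU
    obtain ⟨y, hyZ, hyx⟩ := Metric.mem_closure_iff.mp hxZ r hr
    filter_upwards [ball_mem_nhds x hr] with w hw
    let L : ℂ → E := fun t => y + t • (w - y)
    have hL : Differentiable ℂ L := by fun_prop
    have hSo : IsOpen (L ⁻¹' ball x r) := isOpen_ball.preimage hL.continuous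
    have hSc : Convex ℝ (L ⁻¹' ball x r) := by
      intro a ha b hb p q hp hq hpq
      have hab : L (p • a + q • b) = p • L a + q • L b := by
        simp only [L, smul_add, add_smul, smul_assoc]
        nth_rewrite 1 [← one_smul ℝ y]
        rw [← hpq, add_smul]
        abel
      rw [Set.mem_preimage, hab]
      exact convex_ball x r ha hb hp hq hpq
    have han : AnalyticOnNhd ℂ (f ∘ L) (L ⁻¹' ball x r) :=
      ((hf.mono hrU).comp hL.differentiableOn fun _ h => h).analyticOnNhd hSo
    have hL0 : L 0 = y := by simp [L]
    have hL1 : L 1 = w := by simp [L]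
    have h0S : (0 : ℂ) ∈ L ⁻¹' ball x r := by
      rw [Set.mem_preimage, hL0, mem_ball']
      exact hyx
    have hev : f ∘ L =ᶠ[𝓝 0] 0 := by
      have ht : Tendsto L (𝓝 0) (𝓝 y) := by
        simpa only [hL0] using hL.continuous.tendsto 0
      exact ht.eventually hyZ
    have := han.eqOn_zero_of_preconnected_of_eventuallyEq_zero hSc.isPreconnected h0S hev
      (show (1 : ℂ) ∈ L ⁻¹' ball x r by rwa [Set.mem_preimage, hL1])
    simpa [hL1] using this
  exact fun z hz => (hsub hz).eq_of_nhds

end SeveralComplexVariables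

/-- Key step in the proof of Theorem 2.1(i): let `g₁, …, g_n` be ℂ-linearly independent
holomorphic functions on a connected open neighborhood `U` of `0 ∈ ℂ^N`, let `ε_j ∈ {±1}`,
and let `G(z, w) = Σ ε_j g_j(z) ḡ_j(w)` with `ḡ_j(w) = conj (g_j (conj w))` defined on a
neighborhood `U'` of `0`. If for every multi-index (encoded as a finite sequence of
coordinate directions) the function `z ↦ ∂_w^β G(z, 0)` is a polynomial in `z`, then each
`g_j` is a polynomial. -/
theorem summands_polynomial_of_derivatives_polynomial
    {N n : ℕ} (U : Set (Fin N → ℂ)) (hUo : IsOpen U) (hUc : IsConnected U)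
    (h0U : (0 : Fin N → ℂ) ∈ U)
    (g : Fin n → (Fin N → ℂ) → ℂ) (hg : ∀ j, DifferentiableOn ℂ (g j) U)
    (hli : ∀ c : Fin n → ℂ, (∀ z ∈ U, ∑ j, c j * g j z = 0) → c = 0)
    (ε : Fin n → ℂ) (hε : ∀ j, ε j = 1 ∨ ε j = -1)
    (U' : Set (Fin N → ℂ)) (hU'o : IsOpen U') (h0U' : (0 : Fin N → ℂ) ∈ U')
    (hU'conj : ∀ w ∈ U', (fun i => starRingEnd ℂ (w i)) ∈ U)
    (gbar : Fin n → (Fin N → ℂ) → ℂ)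
    (hgbar : ∀ j, ∀ w : Fin N → ℂ, gbar j w = starRingEnd ℂ (g j fun i => starRingEnd ℂ (w i)))
    (G : (Fin N → ℂ) → (Fin N → ℂ) → ℂ)
    (hG : ∀ z w, G z w = ∑ j, ε j * g j z * gbar j w)
    (hpoly : ∀ (k : ℕ) (v : Fin k → Fin N),
      ∃ P : MvPolynomial (Fin N) ℂ, ∀ z ∈ U,
        iteratedFDeriv ℂ k (G z) 0 (fun t => Pi.single (v t) 1) = MvPolynomial.eval z P) :
    ∀ j, ∃ P : MvPolynomial (Fin N) ℂ, ∀ z ∈ U, g j z = MvPolynomial.eval z P := by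
  set V : Set (Fin N → ℂ) := star ⁻¹' U with hV
  have hVo : IsOpen V := hUo.preimage continuous_star
  have h0V : (0 : Fin N → ℂ) ∈ V := by simpa [hV] using h0U
  have hgbar' : ∀ j, gbar j = star ∘ g j ∘ star := fun j => funext fun w => hgbar j w
  have hgV : ∀ j, DifferentiableOn ℂ (gbar j) V := by
    intro j w hw
    have h := ((hg j).differentiableAt (hUo.mem_nhds hw)).star_star
    rw [star_star] at h
    rw [hgbar' j]
    exact h.differentiableWithinAt
  have hsmooth : ∀ (k : ℕ) (j : Fin n), ContDiffAt ℂ k (gbar j) 0 := fun k j =>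
    ((hgV j).contDiffOn_of_finiteDimensional hVo k).contDiffAt (hVo.mem_nhds h0V)
  have hderiv : ∀ (a : Fin n → ℂ) (k : ℕ), iteratedFDeriv ℂ k (fun w => ∑ j, a j * gbar j w) 0
      = ∑ j, a j • iteratedFDeriv ℂ k (gbar j) 0 := by
    intro a k
    rw [iteratedFDeriv_fun_sum_apply fun j _ => contDiffAt_const.mul (hsmooth k j)]
    exact Finset.sum_congr rfl fun j _ => iteratedFDeriv_const_smul_apply (a := a j) (hsmooth k j)
  -- The coefficient vectors whose combination of the `g j` is a polynomial form a submodule.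
  let W : Submodule ℂ (Fin n → ℂ) :=
    { carrier := {a | ∃ P : MvPolynomial (Fin N) ℂ, ∀ z ∈ U,
        ∑ j, a j * g j z = MvPolynomial.eval z P}
      zero_mem' := ⟨0, by simp⟩
      add_mem' := by
        rintro a b ⟨P, hP⟩ ⟨Q, hQ⟩
        exact ⟨P + Q, fun z hz => by
          simp [add_mul, Finset.sum_add_distrib, hP z hz, hQ z hz]⟩
      smul_mem' := by
        rintro c a ⟨P, hP⟩
        exact ⟨MvPolynomial.C c * P, fun z hz => by
          simp [mul_assoc, ← Finset.mul_sum, hP z hz]⟩ }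
  have hW : W = ⊤ := by
    by_contra hne
    obtain ⟨φ, hφ, hWφ⟩ := W.exists_le_ker_of_lt_top (lt_top_iff_ne_top.mpr hne)
    have hφsum : ∀ a, φ a = ∑ j, a j * φ (Pi.single j 1) := fun a => by
      rw [φ.pi_apply_eq_sum_univ a]
      refine Finset.sum_congr rfl fun j _ => congrArg (fun e => a j * φ e) (funext fun i => ?_)
      simp [Pi.single_apply, eq_comm]
    set c : Fin n → ℂ := fun j => φ (Pi.single j 1) * ε j with hc
    have hvanish : ∀ k, iteratedFDeriv ℂ k (fun w => ∑ j, c j * gbar j w) 0 = 0 := by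
      intro k
      apply ContinuousMultilinearMap.toMultilinearMap_injective
      refine Module.Basis.ext_multilinear (fun _ => Pi.basisFun ℂ (Fin N)) fun v => ?_
      obtain ⟨P, hP⟩ := hpoly k v
      have hmem : (fun j => ε j * iteratedFDeriv ℂ k (gbar j) 0 fun t => Pi.single (v t) 1)
          ∈ W := by
        refine ⟨P, fun z hz => ?_⟩
        rw [← hP z hz, funext (hG z), hderiv (fun j => ε j * g j z) k]
        simp only [sum_apply, smul_apply,
          smul_eq_mul]
        exact Finset.sum_congr rfl fun j _ => by ring
      have h0 := LinearMap.mem_ker.mp (hWφ hmem)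
      rw [hφsum] at h0
      rw [hderiv c k]
      simp only [Pi.basisFun_apply, ContinuousMultilinearMap.coe_coe,
        sum_apply, smul_apply, smul_eq_mul,
        ContinuousMultilinearMap.toMultilinearMap_zero, zero_apply]
      rw [← h0]
      exact Finset.sum_congr rfl fun j _ => by simp only [hc]; ring
    have hev : (fun w => ∑ j, c j * gbar j w) =ᶠ[𝓝 0] 0 :=
      DifferentiableOn.eventuallyEq_zero_of_iteratedFDeriv_eq_zero hVo h0V
        (DifferentiableOn.fun_sum fun j _ => (hgV j).const_mul (c j)) hvanish
    have hstar : Tendsto (star : (Fin N → ℂ) → _) (𝓝 0) (𝓝 0) := by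
      simpa using (continuous_star (R := Fin N → ℂ)).tendsto 0
    have hev' : (fun z => ∑ j, star (c j) * g j z) =ᶠ[𝓝 0] 0 := by
      filter_upwards [hstar.eventually hev] with z hz
      simpa [hgbar'] using congrArg star hz
    have hc0 : (fun j => star (c j)) = 0 := hli _ <|
      DifferentiableOn.eqOn_zero_of_isPreconnected hUo hUc.isPreconnected
        (DifferentiableOn.fun_sum fun j _ => (hg j).const_mul (star (c j))) h0U hev'
    refine hφ (LinearMap.ext fun a => ?_)
    rw [hφsum, LinearMap.zero_apply]
    refine Finset.sum_eq_zero fun j _ => ?_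
    have hεj : ε j ≠ 0 := by rcases hε j with h | h <;> simp [h]
    have hcj : φ (Pi.single j 1) * ε j = 0 := star_eq_zero.mp (congrFun hc0 j)
    rw [(mul_eq_zero.mp hcj).resolve_right hεj, mul_zero]
  intro j
  obtain ⟨P, hP⟩ : Pi.single j 1 ∈ W := hW ▸ Submodule.mem_top
  exact ⟨P, fun z hz => by simpa [Pi.single_apply] using hP z hz⟩
end
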